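/- Let R be a skew-invertible Hecke symmetry on V = ℂ^N with parameter q (q ≠ 0, q ≠ ±1), with skew-inverse Ψ, and let B be the N×N matrix B_i^j = Σ_k Ψ_{ki}^{kj}. Then the assignment l̂_i^j ↦ M(i,j), where M(i,j) is the N×N complex matrix of the linear operator on V sending the basis vector x_k to B_k^j · x_i (i.e., M(i,j) has (r,k)-entry δ_r^i B_k^j), extends to a unital ℂ-algebra homomorphism L̂(R) → Mat_N(ℂ); equivalently, the matrices M(i,j) satisfy the defining relations of the modified reflection equation algebra. -/

import Mathlib

open scoped BigOperators

/-- Amplification of an operator on V⊗V to positions (k, k+1) (0-based) of V^{⊗n}. -/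
def ampl2 {A : Type*} [Semiring A] (N n : ℕ)
    (M : Matrix (Fin N × Fin N) (Fin N × Fin N) A) (k : ℕ) :
    Matrix (Fin n → Fin N) (Fin n → Fin N) A := fun i j =>
  if h : k + 1 < n then
    if ∀ m : Fin n, (m : ℕ) ≠ k → (m : ℕ) ≠ k + 1 → i m = j m then
      M (i ⟨k, Nat.lt_of_succ_lt h⟩, i ⟨k + 1, h⟩)
        (j ⟨k, Nat.lt_of_succ_lt h⟩, j ⟨k + 1, h⟩)
    else 0
  else 0

/-- Amplification of an operator on V to position k (0-based) of V^{⊗n}. -/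
def ampl1 {A : Type*} [Semiring A] (N n : ℕ)
    (X : Matrix (Fin N) (Fin N) A) (k : ℕ) :
    Matrix (Fin n → Fin N) (Fin n → Fin N) A := fun i j =>
  if h : k < n then
    if ∀ m : Fin n, (m : ℕ) ≠ k → i m = j m then
      X (i ⟨k, h⟩) (j ⟨k, h⟩)
    else 0
  else 0

/-- The R-trace of an N×N matrix over an algebra. -/
noncomputable def trR1 {A : Type*} [Ring A] [Algebra ℂ A] (N : ℕ)
    (C : Matrix (Fin N) (Fin N) ℂ) (X : Matrix (Fin N) (Fin N) A) : A :=
  ∑ i : Fin N, ∑ j : Fin N, algebraMap ℂ A (C i j) * X j i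

/-- The full R-trace over all n tensor positions. -/
noncomputable def trRn {A : Type*} [Ring A] [Algebra ℂ A] (N n : ℕ)
    (C : Matrix (Fin N) (Fin N) ℂ)
    (M : Matrix (Fin n → Fin N) (Fin n → Fin N) A) : A :=
  ∑ i : Fin n → Fin N, ∑ j : Fin n → Fin N,
    algebraMap ℂ A (∏ k : Fin n, C (i k) (j k)) * M j i

/-- The matrix L⊗I over the free algebra on N² generators. -/
noncomputable def L1F (N : ℕ) :
    Matrix (Fin N × Fin N) (Fin N × Fin N) (FreeAlgebra ℂ (Fin N × Fin N)) :=
  fun p r => if p.2 = r.2 then FreeAlgebra.ι ℂ (p.1, r.1) else 0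

/-- Defining relations of the reflection equation algebra. -/
inductive REArel (N : ℕ) (R : Matrix (Fin N × Fin N) (Fin N × Fin N) ℂ) :
    FreeAlgebra ℂ (Fin N × Fin N) → FreeAlgebra ℂ (Fin N × Fin N) → Prop
  | rel (p r : Fin N × Fin N) :
      REArel N R
        ((R.map (algebraMap ℂ (FreeAlgebra ℂ (Fin N × Fin N))) * L1F N *
            R.map (algebraMap ℂ (FreeAlgebra ℂ (Fin N × Fin N))) * L1F N) p r)
        ((L1F N * R.map (algebraMap ℂ (FreeAlgebra ℂ (Fin N × Fin N))) * L1F N *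
            R.map (algebraMap ℂ (FreeAlgebra ℂ (Fin N × Fin N)))) p r)

/-- The reflection equation algebra L(R). -/
abbrev REA (N : ℕ) (R : Matrix (Fin N × Fin N) (Fin N × Fin N) ℂ) := RingQuot (REArel N R)

/-- The generating matrix of the RE algebra. -/
noncomputable def Lgen (N : ℕ) (R : Matrix (Fin N × Fin N) (Fin N × Fin N) ℂ) :
    Matrix (Fin N) (Fin N) (REA N R) :=
  fun i j => RingQuot.mkAlgHom ℂ (REArel N R) (FreeAlgebra.ι ℂ (i, j))

/-- Defining relations of the modified reflection equation algebra. -/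
inductive MREArel (N : ℕ) (R : Matrix (Fin N × Fin N) (Fin N × Fin N) ℂ) :
    FreeAlgebra ℂ (Fin N × Fin N) → FreeAlgebra ℂ (Fin N × Fin N) → Prop
  | rel (p r : Fin N × Fin N) :
      MREArel N R
        ((R.map (algebraMap ℂ (FreeAlgebra ℂ (Fin N × Fin N))) * L1F N *
            R.map (algebraMap ℂ (FreeAlgebra ℂ (Fin N × Fin N))) * L1F N -
          L1F N * R.map (algebraMap ℂ (FreeAlgebra ℂ (Fin N × Fin N))) * L1F N *
            R.map (algebraMap ℂ (FreeAlgebra ℂ (Fin N × Fin N)))) p r)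
        ((R.map (algebraMap ℂ (FreeAlgebra ℂ (Fin N × Fin N))) * L1F N -
          L1F N * R.map (algebraMap ℂ (FreeAlgebra ℂ (Fin N × Fin N)))) p r)

/-- The modified reflection equation algebra L̂(R). -/
abbrev MREA (N : ℕ) (R : Matrix (Fin N × Fin N) (Fin N × Fin N) ℂ) := RingQuot (MREArel N R)

/-- The generating matrix of the modified RE algebra. -/
noncomputable def Lhatgen (N : ℕ) (R : Matrix (Fin N × Fin N) (Fin N × Fin N) ℂ) :
    Matrix (Fin N) (Fin N) (MREA N R) :=
  fun i j => RingQuot.mkAlgHom ℂ (MREArel N R) (FreeAlgebra.ι ℂ (i, j))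

/-- The matrices L_{\bar k}, 0-based: Lbar 0 = L₁, Lbar k = R_k Lbar (k-1) R_k⁻¹,
with R⁻¹ = R - (q - q⁻¹)I. -/
noncomputable def Lbar {A : Type*} [Ring A] [Algebra ℂ A] (N n : ℕ)
    (R : Matrix (Fin N × Fin N) (Fin N × Fin N) ℂ) (q : ℂ)
    (L : Matrix (Fin N) (Fin N) A) : ℕ → Matrix (Fin n → Fin N) (Fin n → Fin N) A
  | 0 => ampl1 N n L 0
  | k + 1 =>
      ampl2 N n (R.map (algebraMap ℂ A)) k * Lbar N n R q L k *
        ampl2 N n ((R - (q - q⁻¹) • 1).map (algebraMap ℂ A)) k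

/-- The ordered product L_{\bar 1} L_{\bar 2} ⋯ L_{\bar n}. -/
noncomputable def Ltot {A : Type*} [Ring A] [Algebra ℂ A] (N n : ℕ)
    (R : Matrix (Fin N × Fin N) (Fin N × Fin N) ℂ) (q : ℂ)
    (L : Matrix (Fin N) (Fin N) A) : Matrix (Fin n → Fin N) (Fin n → Fin N) A :=
  ((List.range n).map (Lbar N n R q L)).prod


/-- The partial trace identity `Tr₁ (B₁ R) = I`. -/
theorem trace_B_R (N : ℕ) (R Ψ : Matrix (Fin N × Fin N) (Fin N × Fin N) ℂ)
    (hΨ : ∀ i j k m : Fin N, ∑ a : Fin N, ∑ b : Fin N,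
        R (i, b) (j, a) * Ψ (a, k) (b, m) = if i = m ∧ k = j then 1 else 0)
    (u v : Fin N) :
    ∑ k : Fin N, ∑ m : Fin N, (∑ s : Fin N, Ψ (s, k) (s, m)) * R (m, u) (k, v) =
      if u = v then 1 else 0 := by
  let X : Matrix (Fin N × Fin N) (Fin N × Fin N) ℂ := fun p t => R (p.2, t.2) (p.1, t.1)
  let Y : Matrix (Fin N × Fin N) (Fin N × Fin N) ℂ := fun p t => Ψ (p.1, t.1) (p.2, t.2)
  have hXY : X * Y = 1 := by
    ext ⟨j, i⟩ ⟨k, m⟩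
    rw [Matrix.mul_apply, Fintype.sum_prod_type, Matrix.one_apply]
    simp only [X, Y]
    rw [hΨ i j k m]
    congr 1
    simp only [Prod.mk.injEq, eq_iff_iff]
    tauto
  have hYX : Y * X = 1 := mul_eq_one_comm.mp hXY
  have h : ∀ s, ∑ k : Fin N, ∑ m : Fin N, Ψ (s, k) (s, m) * R (m, u) (k, v) =
      if s = v ∧ s = u then 1 else 0 := by
    intro s
    have := congrFun (congrFun hYX (s, s)) (v, u)
    rw [Matrix.mul_apply, Fintype.sum_prod_type, Matrix.one_apply] at this
    simpa only [X, Y, Prod.mk.injEq] using this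
  calc _ = ∑ s, ∑ k : Fin N, ∑ m : Fin N, Ψ (s, k) (s, m) * R (m, u) (k, v) := by
        simp only [Finset.sum_mul]
        rw [Finset.sum_comm]
        conv_lhs =>
          enter [2, m]
          rw [Finset.sum_comm]
        rw [Finset.sum_comm]
        refine Finset.sum_congr rfl fun s _ => ?_
        rw [Finset.sum_comm]
    _ = _ := by
        simp only [h, ite_and, Finset.sum_ite_eq', Finset.mem_univ, if_true]
        simp [eq_comm]

/-- the assignment l̂_i^j ↦ M(i,j), with M(i,j)_{r,k} = δ_r^i B_k^j where
B_i^j = Σ_s Ψ_{si}^{sj}, extends to a unital ℂ-algebra homomorphism L̂(R) → Mat_N(ℂ). -/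
theorem statement_15 (N : ℕ) (hN : 1 ≤ N) (q : ℂ) (hq0 : q ≠ 0) (hq1 : q ≠ 1) (hqm1 : q ≠ -1)
    (R : Matrix (Fin N × Fin N) (Fin N × Fin N) ℂ)
    (hbraid : ampl2 N 3 R 0 * ampl2 N 3 R 1 * ampl2 N 3 R 0 =
      ampl2 N 3 R 1 * ampl2 N 3 R 0 * ampl2 N 3 R 1)
    (hHecke : (q • (1 : Matrix (Fin N × Fin N) (Fin N × Fin N) ℂ) - R) * (q⁻¹ • 1 + R) = 0)
    (Ψ : Matrix (Fin N × Fin N) (Fin N × Fin N) ℂ)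
    (hΨ : ∀ i j k m : Fin N, ∑ a : Fin N, ∑ b : Fin N,
        R (i, b) (j, a) * Ψ (a, k) (b, m) = if i = m ∧ k = j then 1 else 0) :
    ∃ f : MREA N R →ₐ[ℂ] Matrix (Fin N) (Fin N) ℂ,
      ∀ i j r k : Fin N,
        f (Lhatgen N R i j) r k =
          if r = i then ∑ s : Fin N, Ψ (s, k) (s, j) else 0 := by
  classical
  let M : Fin N × Fin N → Matrix (Fin N) (Fin N) ℂ :=
    fun p r k => if r = p.1 then ∑ s : Fin N, Ψ (s, k) (s, p.2) else 0
  let φ : FreeAlgebra ℂ (Fin N × Fin N) →ₐ[ℂ] Matrix (Fin N) (Fin N) ℂ := FreeAlgebra.lift ℂ M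
  have hMM : ∀ a c d e, M (a, c) * M (d, e) = (∑ s : Fin N, Ψ (s, d) (s, c)) • M (a, e) := by
    intro a c d e
    ext x y
    rw [Matrix.mul_apply, Matrix.smul_apply]
    simp only [M]
    simp
    try (split_ifs <;> simp)
  let RM := R.map (algebraMap ℂ (Matrix (Fin N) (Fin N) ℂ))
  let LM := (L1F N).map φ
  have hR : (R.map (algebraMap ℂ (FreeAlgebra ℂ (Fin N × Fin N)))).map φ = RM := by
    ext1 i j
    simp only [Matrix.map_apply, RM, AlgHom.commutes]
  have hLM : ∀ a b c d, LM (a, b) (c, d) = if b = d then M (a, c) else 0 := by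
    intro a b c d
    simp only [LM, Matrix.map_apply, L1F]
    split_ifs
    · simp [φ]
    · simp
  have key : LM * RM * LM = LM := by
    ext1 ⟨a, b⟩ ⟨c, d⟩
    simp only [Matrix.mul_apply, Fintype.sum_prod_type, hLM, RM, Matrix.map_apply, ite_mul, mul_ite,
      zero_mul, mul_zero, Finset.sum_ite_eq, Finset.sum_ite_eq', Finset.mem_univ, if_true,
      Finset.sum_mul]
    have h1 : ∀ k m : Fin N, M (a, m) * (algebraMap ℂ (Matrix (Fin N) (Fin N) ℂ)) (R (m, b) (k, d))
        * M (k, c) = ((∑ s : Fin N, Ψ (s, k) (s, m)) * R (m, b) (k, d)) • M (a, c) := by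
      intro k m
      rw [← Algebra.commutes, mul_assoc, hMM, ← Algebra.smul_def, smul_smul, mul_comm]
    simp only [h1, ← Finset.sum_smul]
    rw [trace_B_R N R Ψ hΨ b d]
    split_ifs <;> simp
  have hrel : ∀ ⦃x y⦄, MREArel N R x y → φ x = φ y := by
    rintro _ _ ⟨p, r⟩
    have : ∀ A : Matrix (Fin N × Fin N) (Fin N × Fin N) (FreeAlgebra ℂ (Fin N × Fin N)),
      φ (A p r) = φ.mapMatrix A p r := fun A => rfl
    rw [this, this]
    have e1 : φ.mapMatrix (R.map (algebraMap ℂ (FreeAlgebra ℂ (Fin N × Fin N)))) = RM := hR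
    have e2 : φ.mapMatrix (L1F N) = LM := rfl
    simp only [map_sub, map_mul, e1, e2]
    rw [key, mul_assoc RM LM RM, mul_assoc RM (LM * RM) LM, key]
  refine ⟨RingQuot.liftAlgHom ℂ ⟨φ, hrel⟩, fun i j r k => ?_⟩
  simp only [Lhatgen, RingQuot.liftAlgHom_mkAlgHom_apply]
  change FreeAlgebra.lift ℂ M (FreeAlgebra.ι ℂ (i, j)) r k = _
  rw [FreeAlgebra.lift_ι_apply]
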